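/- Let S be a finite nonempty type of states, ≼ a total preorder on S, and Π₁, Π₂ state partitions of S with Π₁ a refinement of Π₂. Let M ⊆ S be nonempty, and assume every ≼-minimal element of Π₂[M] belongs to Π₁[M]. Then min≼(Π₁[M]) = min≼(Π₂[M]); in particular, the model set of the trust-sensitive revision with respect to the more broadly trusted agent (partition Π₁) is contained in the model set of the trust-sensitive revision with respect to the less broadly trusted agent (partition Π₂): |K *^B_A φ| ⊆ |K *^C_A φ|. -/

import Mathlib

/-- A state partition of `S`: a collection of pairwise disjoint,
collectively exhaustive subsets (cells) of `S`. -/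
structure StatePartition (S : Type*) where
  cells : Set (Set S)
  exhaustive : ∀ s : S, ∃ C ∈ cells, s ∈ C
  pairwise_disjoint : ∀ C ∈ cells, ∀ D ∈ cells, C ≠ D → C ∩ D = ∅

/-- `P.expand M` is `Π[M]`: the union of all cells of the partition that
contain at least one element of `M`. -/
def StatePartition.expand {S : Type*} (P : StatePartition S) (M : Set S) : Set S :=
  {t | ∃ C ∈ P.cells, t ∈ C ∧ ∃ s ∈ M, s ∈ C}

/-- `minSet r X`: the elements of `X` that are minimal within `X`
with respect to the total preorder `r` (i.e. `r`-below every element of `X`). -/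
def minSet {S : Type*} (r : S → S → Prop) (X : Set S) : Set S :=
  {x ∈ X | ∀ y ∈ X, r x y}

/-- if `Π₁` refines `Π₂`, `M` is nonempty, and every `≼`-minimal
element of `Π₂[M]` lies in `Π₁[M]`, then the two trust-sensitive revisions
coincide; in particular `min≼(Π₁[M]) ⊆ min≼(Π₂[M])`. -/
theorem refinement_revision_subset {S : Type*} [Fintype S] [Nonempty S]
    (r : S → S → Prop)
    (hrefl : ∀ x, r x x)
    (htrans : ∀ x y z, r x y → r y z → r x z)
    (htotal : ∀ x y, r x y ∨ r y x)
    (P₁ P₂ : StatePartition S)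
    (href : ∀ C₁ ∈ P₁.cells, ∃ C₂ ∈ P₂.cells, C₁ ⊆ C₂)
    (M : Set S) (hM : M.Nonempty)
    (hmin : ∀ x ∈ minSet r (P₂.expand M), x ∈ P₁.expand M) :
    minSet r (P₁.expand M) = minSet r (P₂.expand M) := by
  have hsub : P₁.expand M ⊆ P₂.expand M := by
    rintro t ⟨C, hC, ht, s, hs, hsC⟩
    obtain ⟨D, hD, hCD⟩ := href C hC
    exact ⟨D, hD, hCD ht, s, hs, hCD hsC⟩
  have hne : (P₂.expand M).Nonempty := by
    obtain ⟨m, hm⟩ := hM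
    obtain ⟨C, hC, hmC⟩ := P₂.exhaustive m
    exact ⟨m, C, hC, hmC, m, hm, hmC⟩
  have hex : (minSet r (P₂.expand M)).Nonempty := by
    letI : Preorder S := { le := r, le_refl := hrefl, le_trans := htrans }
    obtain ⟨x, hx⟩ := (Set.toFinite (P₂.expand M)).exists_minimal hne
    refine ⟨x, hx.1, fun y hy => ?_⟩
    rcases htotal x y with h | h
    · exact h
    · exact hx.2 hy h
  obtain ⟨m, hm⟩ := hex
  ext x
  constructor
  · rintro ⟨hx, hxm⟩
    exact ⟨hsub hx, fun y hy => htrans x m y (hxm m (hmin m hm)) (hm.2 y hy)⟩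
  · intro hx
    exact ⟨hmin x hx, fun y hy => hx.2 y (hsub hy)⟩
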